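/- Let α¹ and α² be disjoint locally finite subsets of ℝ with two-sided densities λ and ρ respectively, where 0 < λ < ρ, and let η¹ = D(α¹, α²). Let x ∈ ℝ with x ∉ α¹ ∪ α², let x² = max(α² ∩ (−∞, x)), x¹ = max(α¹ ∩ (−∞, x²)), and z = max(η¹ ∩ (−∞, x)) (all these maxima exist). Define the multi-line jump configuration ᾱ¹ = (α¹ \ {x¹}) ∪ {x²} and ᾱ² = (α² \ {x²}) ∪ {x}. Then the queueing (departure) map intertwines the multi-line jump with the Hammersley jump: D(ᾱ¹, ᾱ²) = (η¹ \ {z}) ∪ {x}. -/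

import Mathlib

open Set Filter Classical

noncomputable section

/-- A subset of `ℝ` is locally finite if its intersection with every bounded interval
is finite. -/
def LocFin (B : Set ℝ) : Prop := ∀ a b : ℝ, (B ∩ Set.Icc a b).Finite

/-- The right-continuous random-walk function `Z` associated to arrivals `A` and services `S`:
`Z 0 = 0` and `Z s - Z r = |A ∩ (r,s]| - |S ∩ (r,s]|` for `r < s`;
`Z` jumps up by 1 at points of `A` and down by 1 at points of `S`. -/
def Zfun (A S : Set ℝ) (r : ℝ) : ℤ :=
  if 0 ≤ r then ((A ∩ Set.Ioc 0 r).ncard : ℤ) - ((S ∩ Set.Ioc 0 r).ncard : ℤ)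
  else ((S ∩ Set.Ioc r 0).ncard : ℤ) - ((A ∩ Set.Ioc r 0).ncard : ℤ)

/-- The pair `(A,S)` is admissible: both sets locally finite and disjoint, and
`Z_r → -∞` as `r → ∞`, `Z_r → +∞` as `r → -∞`. -/
def Admissible (A S : Set ℝ) : Prop :=
  LocFin A ∧ LocFin S ∧ Disjoint A S ∧
  Tendsto (Zfun A S) atTop atBot ∧ Tendsto (Zfun A S) atBot atTop

/-- Unused service times: times `r ∈ S` where `Z` attains a new record down, i.e.
`Z r < Z r'` for all `r' < r` (equivalently `Z_r < inf_{r' < r} Z_{r'}`). -/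
def Unused (A S : Set ℝ) : Set ℝ := {r ∈ S | ∀ r' < r, Zfun A S r < Zfun A S r'}

/-- Departure times: service times that are not unused. -/
def Dep (A S : Set ℝ) : Set ℝ := S \ Unused A S

/-- `B` has two-sided density `ρ`. -/
def HasDens (B : Set ℝ) (ρ : ℝ) : Prop :=
  Tendsto (fun s : ℝ => ((B ∩ Set.Icc 0 s).ncard : ℝ) / s) atTop (nhds ρ) ∧
  Tendsto (fun s : ℝ => ((B ∩ Set.Icc (-s) 0).ncard : ℝ) / s) atTop (nhds ρ)

/-- The queue length `Q_r = Z_r - min_{r' ≤ r} Z_{r'}`. -/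
def Qlen (A S : Set ℝ) (r : ℝ) : ℤ := Zfun A S r - sInf (Zfun A S '' Set.Iic r)

/-- `Dseq α k m = D^{(m+1)}(α_k, α_{k+1}, …, α_{k+m})`, the tandem departure operator:
`D^{(1)}(α¹) = α¹` and `D^{(n)}(α¹,…,αⁿ) = D(D^{(n-1)}(α¹,…,α^{n-1}), αⁿ)`. -/
def Dseq (α : ℕ → Set ℝ) (k : ℕ) : ℕ → Set ℝ
  | 0 => α k
  | m + 1 => Dep (Dseq α k m) (α (k + m + 1))

def cnt (B : Set ℝ) (r : ℝ) : ℤ :=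
  if 0 ≤ r then ((B ∩ Set.Ioc 0 r).ncard : ℤ) else -((B ∩ Set.Ioc r 0).ncard : ℤ)

lemma Zfun_eq (A S : Set ℝ) (r : ℝ) : Zfun A S r = cnt A r - cnt S r := by
  unfold Zfun cnt
  split_ifs <;> ring

lemma LocFin.ioc {B : Set ℝ} (h : LocFin B) (a b : ℝ) : (B ∩ Set.Ioc a b).Finite :=
  (h a b).subset (Set.inter_subset_inter_right _ Set.Ioc_subset_Icc_self)

lemma ncard_split {B : Set ℝ} (h : LocFin B) {a b c : ℝ} (hab : a ≤ b) (hbc : b ≤ c) :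
    (B ∩ Set.Ioc a c).ncard = (B ∩ Set.Ioc a b).ncard + (B ∩ Set.Ioc b c).ncard := by
  rw [← Set.ncard_union_eq _ (h.ioc _ _) (h.ioc _ _), ← Set.inter_union_distrib_left,
    Set.Ioc_union_Ioc_eq_Ioc hab hbc]
  rw [Set.disjoint_left]
  rintro y ⟨_, hy⟩ ⟨_, hy'⟩
  exact absurd hy.2 (not_le.2 hy'.1)

lemma cnt_inc {B : Set ℝ} (h : LocFin B) {r s : ℝ} (hrs : r ≤ s) :
    cnt B s - cnt B r = ((B ∩ Set.Ioc r s).ncard : ℤ) := by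
  unfold cnt
  split_ifs with h1 h2 h2
  · rw [ncard_split h h2 hrs]; push_cast; ring
  · rw [ncard_split h (not_le.1 h2).le h1]; push_cast; ring
  · linarith
  · rw [ncard_split h hrs (not_le.1 h1).le]; push_cast; ring

lemma cnt_insert {B : Set ℝ} (h : LocFin B) {p : ℝ} (hp : p ∉ B) (r : ℝ) :
    cnt (insert p B) r = cnt B r + (if p ≤ r then 1 else 0) - (if p ≤ 0 then 1 else 0) := by
  have key : ∀ a b : ℝ, ((insert p B ∩ Set.Ioc a b).ncard : ℤ) =
      ((B ∩ Set.Ioc a b).ncard : ℤ) + if p ∈ Set.Ioc a b then 1 else 0 := by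
    intro a b
    split_ifs with hm
    · rw [Set.insert_inter_of_mem hm, Set.ncard_insert_of_notMem (fun hh => hp hh.1) (h.ioc _ _)]
      push_cast; rfl
    · rw [Set.insert_inter_of_notMem hm]; simp
  unfold cnt
  split_ifs with h1 h2 h3 h3 h2 h3 h3 <;> rw [key] <;> split_ifs with h4 <;>
    simp only [Set.mem_Ioc, not_and, not_le] at * <;> first | omega | (exfalso; grind)

lemma gap {B : Set ℝ} (h : LocFin B) (t : ℝ) : ∃ r < t, ∀ y ∈ B, r < y → y < t → False := by
  have hf : (B ∩ Set.Ico (t-1) t).Finite :=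
    (h (t-1) t).subset (Set.inter_subset_inter_right _ Set.Ico_subset_Icc_self)
  by_cases hn : (B ∩ Set.Ico (t-1) t).Nonempty
  · obtain ⟨m, hm⟩ := hf.exists_maximalFor id _ hn
    refine ⟨m, hm.1.2.2, fun y hy h1 h2 => ?_⟩
    have := hm.2 (j := y) ⟨hy, hm.1.2.1.trans h1.le, h2⟩ h1.le
    simp only [id] at this
    linarith
  · refine ⟨t-1, by linarith, fun y hy h1 h2 => hn ⟨y, hy, h1.le, h2⟩⟩

lemma exGreatest {B : Set ℝ} (h : LocFin B) {x y : ℝ} (hy : y ∈ B) (hyx : y < x) :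
    ∃ m, IsGreatest (B ∩ Set.Iio x) m := by
  have hf : (B ∩ Set.Ico y x).Finite :=
    (h y x).subset (Set.inter_subset_inter_right _ Set.Ico_subset_Icc_self)
  obtain ⟨m, hm⟩ := hf.exists_maximalFor id _ ⟨y, hy, le_rfl, hyx⟩
  refine ⟨m, ⟨hm.1.1, hm.1.2.2⟩, fun w hw => ?_⟩
  by_contra hc
  have hc' : m < w := not_le.1 hc
  exact hc (hm.2 (j := w) ⟨hw.1, hm.1.2.1.trans hc'.le, hw.2⟩ hc'.le)

lemma exNext {B : Set ℝ} (h : LocFin B) {a b : ℝ} (hb : b ∈ B) (hab : a < b) :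
    ∃ m ∈ B, a < m ∧ m ≤ b ∧ ∀ y ∈ B, a < y → y < m → False := by
  obtain ⟨m, hm⟩ := (h.ioc a b).exists_minimalFor id _ ⟨b, hb, hab, le_rfl⟩
  refine ⟨m, hm.1.1, hm.1.2.1, hm.1.2.2, fun y hy h1 h2 => ?_⟩
  have := hm.2 (j := y) ⟨hy, h1, h2.le.trans hm.1.2.2⟩ h2.le
  simp only [id] at this
  linarith

lemma exBelow {B : Set ℝ} (h : LocFin B) {d : ℝ} (hB : HasDens B d) (hd : 0 < d) (x : ℝ) :
    ∃ y ∈ B, y < x := by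
  by_contra hc
  push Not at hc
  have h1 : Tendsto (fun s : ℝ => ((B ∩ Set.Icc x 0).ncard : ℝ) / s) atTop (nhds 0) :=
    tendsto_const_nhds.div_atTop tendsto_id
  have h2 : d ≤ 0 := by
    refine le_of_tendsto_of_tendsto hB.2 h1 ?_
    filter_upwards [eventually_gt_atTop 0] with s hs
    have : (B ∩ Set.Icc (-s) 0).ncard ≤ (B ∩ Set.Icc x 0).ncard :=
      Set.ncard_le_ncard (fun y hy => ⟨hy.1, hc y hy.1, hy.2.2⟩) (h _ _)
    have : ((B ∩ Set.Icc (-s) 0).ncard : ℝ) ≤ (B ∩ Set.Icc x 0).ncard := by exact_mod_cast this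
    gcongr
  linarith

lemma mem_Dep {A S : Set ℝ} {r : ℝ} :
    r ∈ Dep A S ↔ r ∈ S ∧ ∃ r' < r, Zfun A S r' ≤ Zfun A S r := by
  unfold Dep Unused
  simp only [Set.mem_sdiff, Set.mem_ofPred_eq]
  push Not
  constructor
  · rintro ⟨a, b⟩; exact ⟨a, b a⟩
  · rintro ⟨a, b⟩; exact ⟨a, fun _ => b⟩

lemma Zinc {A S : Set ℝ} (hA : LocFin A) (hS : LocFin S) {r s : ℝ} (hrs : r ≤ s) :
    Zfun A S s = Zfun A S r + ((A ∩ Set.Ioc r s).ncard : ℤ) - ((S ∩ Set.Ioc r s).ncard : ℤ) := by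
  rw [Zfun_eq, Zfun_eq, ← cnt_inc hA hrs, ← cnt_inc hS hrs]; ring

lemma ncard0 {B : Set ℝ} {r s : ℝ} (h : ∀ y ∈ B, r < y → y ≤ s → False) :
    (B ∩ Set.Ioc r s).ncard = 0 := by
  have : B ∩ Set.Ioc r s = ∅ := by
    ext y; simp only [Set.mem_inter_iff, Set.mem_Ioc, Set.mem_empty_iff_false, iff_false]
    rintro ⟨a, b, c⟩; exact h y a b c
  rw [this]; simp

lemma ncard1 {B : Set ℝ} {r s : ℝ} (hs : s ∈ B) (hrs : r < s)
    (h : ∀ y ∈ B, r < y → y < s → False) : (B ∩ Set.Ioc r s).ncard = 1 := by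
  rw [Set.ncard_eq_one]
  refine ⟨s, ?_⟩
  ext y; simp only [Set.mem_inter_iff, Set.mem_Ioc, Set.mem_singleton_iff]
  constructor
  · rintro ⟨a, b, c⟩; exact c.eq_or_lt.resolve_right (h y a b)
  · rintro rfl; exact ⟨hs, hrs, le_rfl⟩

lemma ncardpos {B : Set ℝ} (h : LocFin B) {r s y : ℝ} (hy : y ∈ B) (h1 : r < y) (h2 : y ≤ s) :
    0 < (B ∩ Set.Ioc r s).ncard :=
  (Set.ncard_pos (h.ioc _ _)).2 ⟨y, hy, h1, h2⟩

/-- intertwining of the queueing (departure) map with the jumps, two-line case.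
With `η¹ = D(α¹,α²)`, `x ∉ α¹ ∪ α²`, `x² = max(α² ∩ (-∞,x))`, `x¹ = max(α¹ ∩ (-∞,x²))` and
`z = max(η¹ ∩ (-∞,x))` (all these maxima exist), the multi-line jump configuration
`ᾱ¹ = (α¹ \ {x¹}) ∪ {x²}`, `ᾱ² = (α² \ {x²}) ∪ {x}` satisfies
`D(ᾱ¹,ᾱ²) = (η¹ \ {z}) ∪ {x}`. -/
theorem queue_intertwines_jump_two_lines (α1 α2 : Set ℝ) (lam rho : ℝ)
    (h1 : LocFin α1) (h2 : LocFin α2) (hd : Disjoint α1 α2)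
    (hd1 : HasDens α1 lam) (hd2 : HasDens α2 rho) (h0 : 0 < lam) (hlr : lam < rho)
    (x : ℝ) (hx : x ∉ α1 ∪ α2) :
    ∃ x2 x1 z : ℝ,
      IsGreatest (α2 ∩ Set.Iio x) x2 ∧
      IsGreatest (α1 ∩ Set.Iio x2) x1 ∧
      IsGreatest (Dep α1 α2 ∩ Set.Iio x) z ∧
      Dep ((α1 \ {x1}) ∪ {x2}) ((α2 \ {x2}) ∪ {x}) = (Dep α1 α2 \ {z}) ∪ {x} := by
  have hr0 : 0 < rho := h0.trans hlr
  obtain ⟨y2, hy2, hy2x⟩ := exBelow h2 hd2 hr0 x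
  obtain ⟨x2, hx2⟩ := exGreatest h2 hy2 hy2x
  obtain ⟨y1, hy1, hy1x⟩ := exBelow h1 hd1 h0 x2
  obtain ⟨x1, hx1⟩ := exGreatest h1 hy1 hy1x
  have m2 : x2 ∈ α2 := hx2.1.1
  have l2 : x2 < x := hx2.1.2
  have m1 : x1 ∈ α1 := hx1.1.1
  have l1 : x1 < x2 := hx1.1.2
  have g2 : ∀ y ∈ α2, x2 < y → y < x → False := fun y hy ha hb =>
    absurd (hx2.2 ⟨hy, hb⟩) (not_le.2 ha)
  have g1 : ∀ y ∈ α1, x1 < y → y < x2 → False := fun y hy ha hb =>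
    absurd (hx1.2 ⟨hy, hb⟩) (not_le.2 ha)
  have dj : ∀ y, y ∈ α1 → y ∈ α2 → False := fun y ha hb => Set.disjoint_left.1 hd ha hb
  have xn1 : x ∉ α1 := fun h => hx (Or.inl h)
  have xn2 : x ∉ α2 := fun h => hx (Or.inr h)
  have g1' : ∀ y ∈ α1, x1 < y → y ≤ x2 → False := fun y hy ha hb => by
    rcases hb.eq_or_lt with rfl | hb
    · exact dj _ hy m2
    · exact g1 y hy ha hb
  set Z := Zfun α1 α2 with hZ
  have zinc : ∀ {r s : ℝ}, r ≤ s → Z s = Z r + ((α1 ∩ Set.Ioc r s).ncard : ℤ)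
      - ((α2 ∩ Set.Ioc r s).ncard : ℤ) := fun h => Zinc h1 h2 h
  -- strict decrease on [x1, x2]
  have dec : ∀ r s, x1 ≤ r → r < s → s ≤ x2 → s ∈ α2 → Z s < Z r := by
    intro r s a b c d
    have e1 := zinc b.le
    have e2 : (α1 ∩ Set.Ioc r s).ncard = 0 :=
      ncard0 fun y hy h h' => g1' y hy (a.trans_lt h) (h'.trans c)
    have e3 := ncardpos h2 d b le_rfl
    omega
  have step : ∀ r s, x1 ≤ r → r < s → s ≤ x2 → s ∈ α2 →
      (∀ y ∈ α2, r < y → y < s → False) → Z s = Z r - 1 := by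
    intro r s a b c d e
    have e1 := zinc b.le
    have e2 : (α1 ∩ Set.Ioc r s).ncard = 0 :=
      ncard0 fun y hy h h' => g1' y hy (a.trans_lt h) (h'.trans c)
    have e3 := ncard1 d b e
    omega
  have up : ∀ r, x2 ≤ r → r ≤ x → Z x2 ≤ Z r := by
    intro r a b
    have e1 := zinc a
    have e2 : (α2 ∩ Set.Ioc x2 r).ncard = 0 := ncard0 fun y hy h h' => by
      rcases (h'.trans b).eq_or_lt with rfl | h''
      · exact xn2 hy
      · exact g2 y hy h h''
    omega
  -- value just before x1
  obtain ⟨t1, ht1, Zt1⟩ : ∃ t < x1, Z x1 = Z t + 1 := by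
    obtain ⟨a, ha, ha'⟩ := gap h1 x1
    obtain ⟨b, hb, hb'⟩ := gap h2 x1
    have hm : max a b < x1 := max_lt ha hb
    refine ⟨max a b, hm, ?_⟩
    have e1 := zinc hm.le
    have e2 := ncard1 m1 hm fun y hy h h' => ha' y hy ((le_max_left _ _).trans_lt h) h'
    have e3 : (α2 ∩ Set.Ioc (max a b) x1).ncard = 0 := ncard0 fun y hy h h' => by
      rcases h'.eq_or_lt with rfl | h''
      · exact dj _ m1 hy
      · exact hb' y hy ((le_max_right _ _).trans_lt h) h''
    omega
  obtain ⟨t2, ht2, ht2', Zt2⟩ : ∃ t, x1 ≤ t ∧ t < x2 ∧ Z x2 = Z t - 1 := by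
    obtain ⟨b, hb, hb'⟩ := gap h2 x2
    exact ⟨max x1 b, le_max_left _ _, max_lt l1 hb, step _ _ (le_max_left _ _) (max_lt l1 hb)
      le_rfl m2 fun y hy h h' => hb' y hy ((le_max_right _ _).trans_lt h) h'⟩
  have wit : ∀ r, x1 < r → r ≤ x2 → r ∈ Dep α1 α2 → ∃ r' < x1, Z r' ≤ Z r := by
    intro r a b c
    obtain ⟨c1, r', c2, c3⟩ := mem_Dep.1 c
    rcases lt_or_ge r' x1 with h | h
    · exact ⟨r', h, c3⟩
    · exact absurd (dec r' r h c2 b c1) (not_lt.2 c3)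
  -- z
  obtain ⟨s1, ms1, ls1, ls1', gs1⟩ := exNext h2 m2 l1
  have ds1 : s1 ∈ Dep α1 α2 := by
    refine mem_Dep.2 ⟨ms1, t1, ht1.trans ls1, ?_⟩
    have := step x1 s1 le_rfl ls1 ls1' ms1 gs1
    change Z t1 ≤ Z s1
    omega
  have hDl : LocFin (Dep α1 α2) := fun a b =>
    (h2 a b).subset (Set.inter_subset_inter_left _ Set.sdiff_subset)
  obtain ⟨z, hz⟩ := exGreatest hDl ds1 (ls1'.trans_lt l2)
  have zD : z ∈ Dep α1 α2 := hz.1.1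
  have zx : z < x := hz.1.2
  have zS : z ∈ α2 := zD.1
  have z2 : z ≤ x2 := hx2.2 ⟨zS, zx⟩
  have z1 : x1 < z := ls1.trans_le (hz.2 ⟨ds1, ls1'.trans_lt l2⟩)
  have zmax : ∀ r ∈ Dep α1 α2, r < x → r ≤ z := fun r a b => hz.2 ⟨a, b⟩
  refine ⟨x2, x1, z, hx2, hx1, hz, ?_⟩
  set W := Zfun ((α1 \ {x1}) ∪ {x2}) ((α2 \ {x2}) ∪ {x}) with hW
  have sub1 : LocFin (α1 \ {x1}) := fun a b =>
    (h1 a b).subset (Set.inter_subset_inter_left _ Set.sdiff_subset)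
  have sub2 : LocFin (α2 \ {x2}) := fun a b =>
    (h2 a b).subset (Set.inter_subset_inter_left _ Set.sdiff_subset)
  obtain ⟨c, hc⟩ : ∃ c : ℤ, ∀ r, W r = Z r + c - (if x1 ≤ r then 1 else 0)
      + (if x2 ≤ r then 2 else 0) - (if x ≤ r then 1 else 0) := by
    refine ⟨(if x1 ≤ 0 then 1 else 0) - (if x2 ≤ 0 then 2 else 0) + (if x ≤ 0 then 1 else 0),
      fun r => ?_⟩
    have a1 := cnt_insert sub1 (p := x1) (by simp) r
    have a2 := cnt_insert sub1 (p := x2) (fun h => dj _ h.1 m2) r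
    have a3 := cnt_insert sub2 (p := x2) (by simp) r
    have a4 := cnt_insert sub2 (p := x) (fun h => xn2 h.1) r
    rw [Set.insert_sdiff_singleton, Set.insert_eq_of_mem m1] at a1
    rw [Set.insert_sdiff_singleton, Set.insert_eq_of_mem m2] at a3
    rw [hW, hZ, Zfun_eq, Zfun_eq, Set.union_singleton, Set.union_singleton, a1, a2, a3, a4]
    split_ifs <;> ring
  have w0 : ∀ r, r < x1 → W r = Z r + c := by
    intro r h; rw [hc, if_neg (by linarith), if_neg (by linarith), if_neg (by linarith)]; ring
  have w1 : ∀ r, x1 ≤ r → r < x2 → W r = Z r + c - 1 := by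
    intro r h h'; rw [hc, if_pos h, if_neg (by linarith), if_neg (by linarith)]; ring
  have w2 : ∀ r, x2 ≤ r → r < x → W r = Z r + c + 1 := by
    intro r h h'; rw [hc, if_pos (by linarith), if_pos (by linarith), if_neg (by linarith)]; ring
  have w3 : ∀ r, x ≤ r → W r = Z r + c := by
    intro r h; rw [hc, if_pos (by linarith), if_pos (by linarith), if_pos (by linarith)]; ring
  clear_value Z W
  ext r
  rw [mem_Dep, ← hW]
  simp only [Set.mem_union, Set.mem_sdiff, Set.mem_singleton_iff]
  have mD : r ∈ Dep α1 α2 ↔ r ∈ α2 ∧ ∃ r' < r, Z r' ≤ Z r := by rw [mem_Dep, hZ]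
  by_cases hrx : r = x
  · subst hrx
    refine ⟨fun _ => Or.inr rfl, fun _ => ⟨Or.inr rfl, t2, by linarith, ?_⟩⟩
    rw [w1 t2 ht2 ht2', w3 r le_rfl]
    have := up r l2.le le_rfl
    omega
  by_cases hr2 : r = x2
  · subst hr2
    constructor
    · rintro ⟨⟨_, h⟩ | h, _⟩
      · exact absurd rfl h
      · exact absurd h hrx
    · rintro (⟨h, h'⟩ | h)
      · exact absurd (le_antisymm (zmax _ h l2) z2) h'
      · exact absurd h hrx
  simp only [hrx, hr2, or_false, not_false_eq_true, and_true]
  by_cases hr : r ∈ α2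
  swap
  · exact ⟨fun h => absurd h.1 hr, fun h => absurd h.1.1 hr⟩
  rcases lt_or_ge r x1 with c1 | c1
  · rw [mD]
    have hne : r ≠ z := (c1.trans z1).ne
    simp only [hne, not_false_eq_true, and_true]
    refine and_congr_right fun _ => exists_congr fun r' => and_congr_right fun h => ?_
    rw [w0 r c1, w0 r' (h.trans c1)]
    omega
  rcases lt_or_ge r x2 with c2 | c2
  · have c1' : x1 < r := lt_of_le_of_ne c1 (fun h => dj _ m1 (h ▸ hr))
    constructor
    · rintro ⟨_, r', h, h'⟩
      have hr' : r' < x1 := by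
        by_contra hcon
        rw [not_lt] at hcon
        have := dec r' r hcon h c2.le hr
        rw [w1 r c1 c2, w1 r' hcon (h.trans c2)] at h'
        omega
      rw [w0 r' hr', w1 r c1 c2] at h'
      refine ⟨mD.2 ⟨hr, r', h, by omega⟩, ?_⟩
      rintro rfl
      obtain ⟨s, ms, ls, ls', gs⟩ := exNext h2 m2 c2
      have e := step r s c1 ls ls' ms gs
      have : s ∈ Dep α1 α2 := mem_Dep.2 ⟨ms, r', h.trans ls, by rw [← hZ]; omega⟩
      exact absurd (zmax s this (ls'.trans_lt l2)) (not_le.2 ls)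
    · rintro ⟨hD, hne⟩
      have hlt : r < z := lt_of_le_of_ne (zmax r hD (c2.trans l2)) hne
      obtain ⟨r', h, h'⟩ := wit z z1 z2 zD
      have := dec r z c1 hlt z2 zS
      refine ⟨hr, r', h.trans c1', ?_⟩
      rw [w0 r' h, w1 r c1 c2]
      omega
  have c3 : x < r := by
    by_contra hcon
    exact g2 r hr (lt_of_le_of_ne c2 (Ne.symm hr2)) (lt_of_le_of_ne (not_lt.1 hcon) hrx)
  have hne : r ≠ z := (zx.trans c3).ne'
  rw [mD]
  simp only [hne, not_false_eq_true, and_true]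
  refine and_congr_right fun _ => ?_
  rw [w3 r c3.le]
  constructor
  · rintro ⟨r', h, h'⟩
    rcases lt_or_ge r' x1 with d1 | d1
    · rw [w0 r' d1] at h'; exact ⟨r', h, by omega⟩
    rcases lt_or_ge r' x2 with d2 | d2
    · rw [w1 r' d1 d2] at h'
      have := dec r' x2 d1 d2 le_rfl m2
      exact ⟨x2, l2.trans c3, by omega⟩
    rcases lt_or_ge r' x with d3 | d3
    · rw [w2 r' d2 d3] at h'; exact ⟨r', h, by omega⟩
    · rw [w3 r' d3] at h'; exact ⟨r', h, by omega⟩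
  · rintro ⟨r', h, h'⟩
    rcases lt_or_ge r' x1 with d1 | d1
    · exact ⟨r', h, by rw [w0 r' d1]; omega⟩
    rcases lt_or_ge r' x2 with d2 | d2
    · exact ⟨r', h, by rw [w1 r' d1 d2]; omega⟩
    rcases lt_or_ge r' x with d3 | d3
    · have := up r' d2 d3.le
      exact ⟨t2, by linarith, by rw [w1 t2 ht2 ht2']; omega⟩
    · exact ⟨r', h, by rw [w3 r' d3]; omega⟩
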